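/- Let m ≥ 1 and N ≥ 2 be integers and let p be a real number with 1 < p ≤ N − 1. Suppose f_1,…,f_m satisfy (C1)–(C2), b_1,…,b_m : [0,∞) → [0,∞) are continuous, R > 0, and (w_1,…,w_m) is a radial solution of the system with coefficients b_1,…,b_m and initial value β = 1/m (so that Σ_{i=1}^m w_i(0) = 1). Set φ_i^R = max_{0 ≤ r ≤ R} b_i(r). Then ∫_1^{Σ_{i=1}^m w_i(R)} [ ∫_1^t Σ_{i=1}^m f_i(s,…,s) ds ]^{−1/p} dt ≤ ( (p m^{p−1}/(p−1)) Σ_{i=1}^m φ_i^R )^{1/p} R. -/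

import Mathlib

open Real MeasureTheory Filter Set intervalIntegral

/-- `F(s) = ∫_0^s Σ_{i=1}^m f_i(t,…,t) dt`. -/
noncomputable def Fsum (m : ℕ) (f : Fin m → (Fin m → ℝ) → ℝ) (s : ℝ) : ℝ :=
  ∫ t in (0:ℝ)..s, ∑ i, f i (fun _ => t)

/-- Conditions (C1)–(C2): each `f j` maps `[0,∞)^m` to `[0,∞)`, is continuously
differentiable in each variable, vanishes at the origin, is positive when all
arguments are positive, and is nondecreasing in each variable. -/
def SatC12 (m : ℕ) (f : Fin m → (Fin m → ℝ) → ℝ) : Prop :=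
  (∀ j (i : Fin m) (s : Fin m → ℝ), (∀ l, 0 ≤ s l) →
    ContDiffOn ℝ 1 (fun t => f j (Function.update s i t)) (Set.Ici 0)) ∧
  (∀ j s, (∀ l, 0 ≤ s l) → 0 ≤ f j s) ∧
  (∀ j, f j (fun _ => 0) = 0) ∧
  (∀ j s, (∀ l, 0 < s l) → 0 < f j s) ∧
  (∀ j s t, (∀ l, 0 ≤ s l) → (∀ l, s l ≤ t l) → f j s ≤ f j t)

/-- Condition (C3): `∫_1^∞ F(s)^(-1/p) ds = ∞`. -/
def SatC3 (m : ℕ) (p : ℝ) (f : Fin m → (Fin m → ℝ) → ℝ) : Prop :=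
  Tendsto (fun r => ∫ s in (1:ℝ)..r, (Fsum m f s) ^ (-1/p)) atTop atTop

/-- A radial solution of the system with coefficients `b` and initial value `β`:
`w i r = β + ∫_0^r (t^(1-N) ∫_0^t s^(N-1) b i s · f i (w₁(s),…,w_m(s)) ds)^(1/(p-1)) dt`. -/
def IsRadialSolution (m N : ℕ) (p : ℝ) (b : Fin m → ℝ → ℝ)
    (f : Fin m → (Fin m → ℝ) → ℝ) (β : ℝ) (w : Fin m → ℝ → ℝ) : Prop :=
  (∀ i, ContinuousOn (w i) (Set.Ici 0)) ∧
  (∀ i r, 0 ≤ r → 0 ≤ w i r) ∧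
  (∀ i r, 0 ≤ r → w i r = β + ∫ t in (0:ℝ)..r,
      (t ^ (1 - (N:ℝ)) * ∫ s in (0:ℝ)..t,
        s ^ ((N:ℝ) - 1) * b i s * f i (fun j => w j s)) ^ (1/(p-1)))

lemma aux_upper (m : ℕ) (g : (Fin m → ℝ) → ℝ)
    (hc : ∀ (i : Fin m) (s : Fin m → ℝ), (∀ l, 0 ≤ s l) →
      ContinuousOn (fun t => g (Function.update s i t)) (Set.Ici 0))
    (x : Fin m → ℝ) (hx : ∀ l, 0 ≤ x l) (S : Finset (Fin m)) :
    ∀ ε > 0, ∃ y : Fin m → ℝ, (∀ l ∈ S, x l < y l) ∧ (∀ l, l ∉ S → y l = x l) ∧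
      (∀ l, 0 ≤ y l) ∧ g y < g x + ε := by
  classical
  induction S using Finset.induction_on with
  | empty => intro ε hε; exact ⟨x, by simp, by simp, hx, by linarith⟩
  | insert i S hi ih =>
    intro ε hε
    obtain ⟨y, h1, h2, h3, h4⟩ := ih (ε/2) (by linarith)
    have hcont := (hc i y h3) (y i) (h3 i)
    have hcont2 : Tendsto (fun t => g (Function.update y i t)) (nhdsWithin (y i) (Ioi (y i)))
        (nhds (g y)) := by
      have := hcont.mono_left (nhdsWithin_mono (y i)
        (show Ioi (y i) ⊆ Ici 0 from fun t ht => le_trans (h3 i) (le_of_lt ht)))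
      simpa using this
    have hev := hcont2.eventually (gt_mem_nhds (show g y < g y + ε/2 by linarith))
    obtain ⟨t, ht1, ht2⟩ := (hev.and self_mem_nhdsWithin).exists
    have ht2' : y i < t := ht2
    refine ⟨Function.update y i t, ?_, ?_, ?_, by linarith⟩
    · intro l hl
      by_cases hli : l = i
      · subst hli
        simp only [Function.update_self]
        rw [← h2 l hi]; exact ht2'
      · rw [Function.update_of_ne hli]
        exact h1 l ((Finset.mem_insert.1 hl).resolve_left hli)
    · intro l hl
      rw [Finset.mem_insert, not_or] at hl
      rw [Function.update_of_ne hl.1]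
      exact h2 l hl.2
    · intro l
      by_cases hli : l = i
      · subst hli
        simp only [Function.update_self]
        linarith [h3 l]
      · rw [Function.update_of_ne hli]
        exact h3 l

lemma aux_lower (m : ℕ) (g : (Fin m → ℝ) → ℝ)
    (hc : ∀ (i : Fin m) (s : Fin m → ℝ), (∀ l, 0 ≤ s l) →
      ContinuousOn (fun t => g (Function.update s i t)) (Set.Ici 0))
    (x : Fin m → ℝ) (hx : ∀ l, 0 ≤ x l) (S : Finset (Fin m)) :
    ∀ ε > 0, ∃ y : Fin m → ℝ, (∀ l ∈ S, y l < x l ∨ y l = 0) ∧ (∀ l, l ∉ S → y l = x l) ∧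
      (∀ l, 0 ≤ y l) ∧ g x - ε < g y := by
  classical
  induction S using Finset.induction_on with
  | empty => intro ε hε; exact ⟨x, by simp, by simp, hx, by linarith⟩
  | insert i S hi ih =>
    intro ε hε
    obtain ⟨y, h1, h2, h3, h4⟩ := ih (ε/2) (by linarith)
    by_cases hy0 : y i = 0
    · refine ⟨y, ?_, ?_, h3, by linarith⟩
      · intro l hl
        rcases Finset.mem_insert.1 hl with h | h
        · subst h; exact Or.inr hy0
        · exact h1 l h
      · intro l hl
        rw [Finset.mem_insert, not_or] at hl
        exact h2 l hl.2
    have hypos : 0 < y i := lt_of_le_of_ne (h3 i) (Ne.symm hy0)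
    have hcont := ((hc i y h3).continuousAt (Ici_mem_nhds hypos))
    have hcont2 : Tendsto (fun t => g (Function.update y i t)) (nhdsWithin (y i) (Iio (y i)))
        (nhds (g y)) := by
      have := hcont.tendsto.mono_left (nhdsWithin_le_nhds (s := Iio (y i)))
      simpa using this
    have hev := hcont2.eventually (lt_mem_nhds (show g y - ε/2 < g y by linarith))
    have hev2 : ∀ᶠ t in nhdsWithin (y i) (Iio (y i)), 0 < t :=
      nhdsWithin_le_nhds (lt_mem_nhds hypos)
    obtain ⟨t, ⟨ht1, ht3⟩, ht2⟩ := ((hev.and hev2).and self_mem_nhdsWithin).exists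
    have ht2' : t < y i := ht2
    refine ⟨Function.update y i t, ?_, ?_, ?_, by linarith⟩
    · intro l hl
      by_cases hli : l = i
      · subst hli
        simp only [Function.update_self]
        rw [← h2 l hi]; exact Or.inl ht2'
      · rw [Function.update_of_ne hli]
        exact h1 l ((Finset.mem_insert.1 hl).resolve_left hli)
    · intro l hl
      rw [Finset.mem_insert, not_or] at hl
      rw [Function.update_of_ne hl.1]
      exact h2 l hl.2
    · intro l
      by_cases hli : l = i
      · subst hli
        simp only [Function.update_self]
        linarith
      · rw [Function.update_of_ne hli]
        exact h3 l

lemma aux_cont (m : ℕ) (g : (Fin m → ℝ) → ℝ)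
    (hc : ∀ (i : Fin m) (s : Fin m → ℝ), (∀ l, 0 ≤ s l) →
      ContinuousOn (fun t => g (Function.update s i t)) (Set.Ici 0))
    (hmono : ∀ s t : Fin m → ℝ, (∀ l, 0 ≤ s l) → (∀ l, s l ≤ t l) → g s ≤ g t) :
    Continuous (fun s : Fin m → ℝ => g (fun l => max (s l) 0)) := by
  rw [continuous_iff_continuousAt]
  intro x
  have hcl : ∀ l : Fin m, Continuous (fun z : Fin m → ℝ => max (z l) 0) := fun l => by fun_prop
  refine tendsto_order.2 ⟨fun a ha => ?_, fun a ha => ?_⟩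
  · obtain ⟨y, h1, -, h3, h4⟩ := aux_lower m g hc (fun l => max (x l) 0)
      (fun l => le_max_right _ _) Finset.univ (g (fun l => max (x l) 0) - a) (by linarith)
    have : ∀ᶠ z in nhds x, ∀ l, y l ≤ max (z l) 0 := by
      rw [Filter.eventually_all]
      intro l
      rcases h1 l (Finset.mem_univ l) with h | h
      · exact ((hcl l).continuousAt.eventually (lt_mem_nhds h)).mono fun z hz => le_of_lt hz
      · exact Filter.Eventually.of_forall fun z => by rw [h]; exact le_max_right _ _
    filter_upwards [this] with z hz
    have := hmono _ _ h3 hz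
    linarith
  · obtain ⟨y, h1, -, h3, h4⟩ := aux_upper m g hc (fun l => max (x l) 0)
      (fun l => le_max_right _ _) Finset.univ (a - g (fun l => max (x l) 0)) (by linarith)
    have : ∀ᶠ z in nhds x, ∀ l, max (z l) 0 ≤ y l := by
      rw [Filter.eventually_all]
      intro l
      exact ((hcl l).continuousAt.eventually (gt_mem_nhds (h1 l (Finset.mem_univ l)))).mono
        fun z hz => le_of_lt hz
    filter_upwards [this] with z hz
    have := hmono _ _ (fun l => le_max_right (z l) 0) hz
    linarith

lemma aux_h (n : ℝ) (hn : 1 ≤ n) (k : ℝ → ℝ) (hk : Continuous k) (hk0 : ∀ s, 0 ≤ k s)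
    (h : ℝ → ℝ) (hh : ∀ t, h t = t ^ (1 - n) * ∫ s in (0:ℝ)..t, s ^ (n - 1) * k s) :
    (∀ t, 0 ≤ t → 0 ≤ h t) ∧ h 0 = 0 ∧ ContinuousOn h (Ici 0) ∧
    (∀ t, 0 < t → ∃ h', HasDerivAt h h' t ∧ h' ≤ k t) := by
  have hcI : Continuous (fun s : ℝ => s ^ (n - 1) * k s) :=
    (Real.continuous_rpow_const (by linarith)).mul hk
  have hH0 : ∀ t, 0 ≤ t → 0 ≤ ∫ s in (0:ℝ)..t, s ^ (n - 1) * k s := fun t ht =>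
    intervalIntegral.integral_nonneg ht fun s hs => mul_nonneg (Real.rpow_nonneg hs.1 _) (hk0 s)
  have hnn : ∀ t, 0 ≤ t → 0 ≤ h t := fun t ht => by
    rw [hh]; exact mul_nonneg (Real.rpow_nonneg ht _) (hH0 t ht)
  have hz : h 0 = 0 := by rw [hh]; simp
  have hder : ∀ t, 0 < t → ∃ h', HasDerivAt h h' t ∧ h' ≤ k t := by
    intro t ht
    have d1 : HasDerivAt (fun t : ℝ => t ^ (1 - n)) ((1 - n) * t ^ (1 - n - 1)) t :=
      Real.hasDerivAt_rpow_const (Or.inl ht.ne')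
    have d2 : HasDerivAt (fun t : ℝ => ∫ s in (0:ℝ)..t, s ^ (n - 1) * k s)
        (t ^ (n - 1) * k t) t := hcI.integral_hasStrictDerivAt 0 t |>.hasDerivAt
    have d3 := d1.mul d2
    refine ⟨_, d3.congr_of_eventuallyEq (Filter.Eventually.of_forall fun s => hh s), ?_⟩
    have e1 : t ^ (1 - n) * (t ^ (n - 1) * k t) = k t := by
      rw [← mul_assoc, ← Real.rpow_add ht]; simp
    rw [e1]
    have : 0 ≤ (n - 1) * t ^ (1 - n - 1) * ∫ s in (0:ℝ)..t, s ^ (n - 1) * k s :=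
      mul_nonneg (mul_nonneg (by linarith) (Real.rpow_nonneg ht.le _)) (hH0 t ht.le)
    nlinarith
  refine ⟨hnn, hz, ?_, hder⟩
  intro t ht
  rcases eq_or_lt_of_le (show (0:ℝ) ≤ t from ht) with h0 | h0
  · subst h0
    obtain ⟨M, hM⟩ := (isCompact_Icc (a := (0:ℝ)) (b := 1)).bddAbove_image hk.continuousOn
    have hMb : ∀ s ∈ Icc (0:ℝ) 1, k s ≤ M := fun s hs => hM ⟨s, hs, rfl⟩
    have hbd : ∀ t ∈ Icc (0:ℝ) 1, h t ≤ M * t := by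
      intro t ht
      rcases eq_or_lt_of_le ht.1 with h0 | h0
      · rw [← h0, hz]; simp
      have : ∫ s in (0:ℝ)..t, s ^ (n - 1) * k s ≤ ∫ s in (0:ℝ)..t, t ^ (n - 1) * M := by
        apply intervalIntegral.integral_mono_on ht.1 (hcI.intervalIntegrable _ _)
          (continuous_const.intervalIntegrable _ _)
        intro s hs
        exact mul_le_mul (Real.rpow_le_rpow hs.1 hs.2 (by linarith))
          (hMb s ⟨hs.1, hs.2.trans ht.2⟩) (hk0 s) (Real.rpow_nonneg ht.1 _)
      rw [intervalIntegral.integral_const, smul_eq_mul, sub_zero] at this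
      rw [hh]
      calc _ ≤ t ^ (1 - n) * (t * (t ^ (n - 1) * M)) :=
            mul_le_mul_of_nonneg_left this (Real.rpow_nonneg ht.1 _)
        _ = (t ^ (1 - n) * t ^ (n - 1)) * (M * t) := by ring
        _ = M * t := by rw [← Real.rpow_add h0]; simp
    unfold ContinuousWithinAt
    rw [hz]
    have hM0 : Tendsto (fun t : ℝ => M * t) (nhdsWithin 0 (Ici 0)) (nhds 0) := by
      have : Continuous (fun t : ℝ => M * t) := by fun_prop
      have := this.tendsto 0
      rw [mul_zero] at this
      exact this.mono_left nhdsWithin_le_nhds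
    refine tendsto_of_tendsto_of_tendsto_of_le_of_le' tendsto_const_nhds hM0 ?_ ?_
    · filter_upwards [self_mem_nhdsWithin] with s hs using hnn s hs
    · have : ∀ᶠ s in nhdsWithin (0:ℝ) (Ici 0), s < 1 :=
        nhdsWithin_le_nhds (gt_mem_nhds one_pos)
      filter_upwards [self_mem_nhdsWithin, this] with s hs hs1 using hbd s ⟨hs, hs1.le⟩
  · obtain ⟨h', hd, -⟩ := hder t h0
    exact hd.continuousAt.continuousWithinAt

/-- The key a priori bound at radius `R`: with `φ_i^R = max_{0 ≤ r ≤ R} b_i(r)`,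
`∫_1^{Σ w_i(R)} [∫_1^t Σ f_i(s,…,s) ds]^(-1/p) dt ≤ ((p m^(p-1)/(p-1)) Σ φ_i^R)^(1/p) R`. -/
theorem stmt6 (m N : ℕ) (p : ℝ) (hm : 1 ≤ m) (hN : 2 ≤ N)
    (hp1 : 1 < p) (hpN : p ≤ (N:ℝ) - 1)
    (f : Fin m → (Fin m → ℝ) → ℝ) (hf12 : SatC12 m f)
    (b : Fin m → ℝ → ℝ) (hbc : ∀ j, ContinuousOn (b j) (Set.Ici 0))
    (hbnn : ∀ j r, 0 ≤ r → 0 ≤ b j r)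
    (R : ℝ) (hR : 0 < R)
    (w : Fin m → ℝ → ℝ) (hw : IsRadialSolution m N p b f (1/m) w) :
    ∫ t in (1:ℝ)..(∑ i, w i R),
        (∫ s in (1:ℝ)..t, ∑ i, f i (fun _ => s)) ^ (-1/p)
      ≤ ((p * (m:ℝ) ^ (p-1) / (p-1)) * ∑ i, sSup (b i '' Set.Icc 0 R)) ^ (1/p) * R := by
  obtain ⟨hC, hnn, -, hpos, hmono⟩ := hf12
  obtain ⟨hwc, hwnn, hweq⟩ := hw
  have hp0 : 0 < p := by linarith
  have hq0 : 0 < p - 1 := by linarith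
  have hm0 : (0:ℝ) < m := by exact_mod_cast hm
  have fc : ∀ i, Continuous (fun s : Fin m → ℝ => f i (fun l => max (s l) 0)) := fun i =>
    aux_cont m (f i) (fun j s hs => (hC i j s hs).continuousOn) (hmono i)
  have hmaxc : Continuous (fun s : ℝ => max s 0) := by fun_prop
  -- the reaction term
  obtain ⟨k, hk⟩ : ∃ k : Fin m → ℝ → ℝ, ∀ i s, k i s =
      b i (max s 0) * f i (fun j => max (w j (max s 0)) 0) := ⟨_, fun _ _ => rfl⟩
  have kc : ∀ i, Continuous (k i) := by
    intro i
    have h1 : Continuous (fun s : ℝ => b i (max s 0)) :=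
      (hbc i).comp_continuous hmaxc (fun s => mem_Ici.2 (le_max_right s 0))
    have h2 : Continuous (fun s : ℝ => (fun j => w j (max s 0))) :=
      continuous_pi fun j => (hwc j).comp_continuous hmaxc (fun s => mem_Ici.2 (le_max_right s 0))
    have h3 := h1.mul ((fc i).comp h2)
    have : k i = fun s => b i (max s 0) * f i (fun j => max (w j (max s 0)) 0) := funext (hk i)
    rw [this]; exact h3
  have k0 : ∀ i s, 0 ≤ k i s := fun i s => by
    rw [hk]
    exact mul_nonneg (hbnn i _ (le_max_right _ _)) (hnn i _ fun l => le_max_right _ _)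
  obtain ⟨h, hh⟩ : ∃ h : Fin m → ℝ → ℝ, ∀ i t, h i t =
      t ^ (1 - (N:ℝ)) * ∫ s in (0:ℝ)..t, s ^ ((N:ℝ) - 1) * k i s := ⟨_, fun _ _ => rfl⟩
  have hA := fun i => aux_h (N:ℝ) (by linarith) (k i) (kc i) (k0 i) (h i) (hh i)
  have hh0 : ∀ i t, 0 ≤ t → 0 ≤ h i t := fun i => (hA i).1
  obtain ⟨g, hg⟩ : ∃ g : Fin m → ℝ → ℝ, ∀ i t, g i t = (h i t) ^ (1/(p-1)) := ⟨_, fun _ _ => rfl⟩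
  have hg0 : ∀ i t, 0 ≤ t → 0 ≤ g i t := fun i t ht => by
    rw [hg]; exact Real.rpow_nonneg (hh0 i t ht) _
  have hgc : ∀ i, Continuous (fun t => g i (max t 0)) := by
    intro i
    have h1 : Continuous (fun t => h i (max t 0)) :=
      (hA i).2.2.1.comp_continuous hmaxc (fun s => mem_Ici.2 (le_max_right s 0))
    have : (fun t => g i (max t 0)) = fun t => (h i (max t 0)) ^ (1/(p-1)) :=
      funext fun t => hg i _
    rw [this]
    exact h1.rpow_const fun t => Or.inr (by positivity)
  have hwg : ∀ i r, 0 ≤ r → w i r = 1/m + ∫ t in (0:ℝ)..r, g i (max t 0) := by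
    intro i r hr
    rw [hweq i r hr]
    congr 1
    apply intervalIntegral.integral_congr
    intro t ht
    rw [uIcc_of_le hr] at ht
    simp only
    rw [max_eq_left ht.1, hg, hh]
    congr 2
    apply intervalIntegral.integral_congr
    intro s hs
    rw [uIcc_of_le ht.1] at hs
    simp only
    rw [hk, max_eq_left hs.1, mul_assoc]
    congr 3
    funext j
    rw [max_eq_left (hwnn j s hs.1)]
  have hwd : ∀ i r, 0 < r → HasDerivAt (w i) (g i r) r := by
    intro i r hr
    have d := ((hgc i).integral_hasStrictDerivAt 0 r).hasDerivAt.const_add (1/(m:ℝ))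
    rw [max_eq_left hr.le] at d
    refine d.congr_of_eventuallyEq ?_
    filter_upwards [lt_mem_nhds hr] with t ht using hwg i t ht.le
  obtain ⟨W, hW⟩ : ∃ W : ℝ → ℝ, ∀ t, W t = ∑ i, w i t := ⟨_, fun _ => rfl⟩
  have hWfun : W = fun t => ∑ i, w i t := funext hW
  have hWd : ∀ r, 0 < r → HasDerivAt W (∑ i, g i r) r := by
    intro r hr
    rw [hWfun]
    exact HasDerivAt.fun_sum fun i _ => hwd i r hr
  have hWc : ContinuousOn W (Ici 0) := by
    rw [hWfun]; exact continuousOn_finsetSum _ fun i _ => hwc i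
  have hW0 : W 0 = 1 := by
    rw [hW]
    have : ∀ i, w i 0 = 1/m := fun i => by rw [hwg i 0 le_rfl]; simp
    simp only [this]
    simp
    field_simp
  have hgs0 : ∀ t, 0 ≤ t → 0 ≤ ∑ i, g i t := fun t ht => Finset.sum_nonneg fun i _ => hg0 i t ht
  have hWm : MonotoneOn W (Ici 0) := by
    apply monotoneOn_of_deriv_nonneg (convex_Ici 0) hWc
    · rw [interior_Ici]
      exact fun t ht => (hWd t ht).differentiableAt.differentiableWithinAt
    · rw [interior_Ici]
      intro t ht
      rw [(hWd t ht).deriv]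
      exact hgs0 t (le_of_lt ht)
  have hW1 : ∀ t, 0 ≤ t → 1 ≤ W t := fun t ht => by
    rw [← hW0]; exact hWm (mem_Ici.2 le_rfl) ht ht
  -- diagonal values
  obtain ⟨e, he⟩ : ∃ e : Fin m → ℝ → ℝ, ∀ i s, e i s = f i (fun _ => max s 0) :=
    ⟨_, fun _ _ => rfl⟩
  have ec : ∀ i, Continuous (e i) := by
    intro i
    have h2 : Continuous (fun s : ℝ => (fun _ : Fin m => s)) := by fun_prop
    have : e i = fun s => f i (fun _ => max s 0) := funext (he i)
    rw [this]; exact (fc i).comp h2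
  have e0 : ∀ i s, 0 ≤ e i s := fun i s => by
    rw [he]; exact hnn i _ fun _ => le_max_right _ _
  obtain ⟨φ, hφ⟩ : ∃ φ : Fin m → ℝ, ∀ i, φ i = sSup (b i '' Set.Icc 0 R) := ⟨_, fun _ => rfl⟩
  have hbφ : ∀ i, ∀ t ∈ Icc 0 R, b i t ≤ φ i := by
    intro i t ht
    rw [hφ]
    exact le_csSup (isCompact_Icc.bddAbove_image ((hbc i).mono Icc_subset_Ici_self)) ⟨t, ht, rfl⟩
  have φ0 : ∀ i, 0 ≤ φ i := fun i =>
    (hbnn i 0 le_rfl).trans (hbφ i 0 ⟨le_rfl, hR.le⟩)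
  have hke : ∀ i, ∀ t ∈ Icc 0 R, k i t ≤ φ i * e i (W t) := by
    intro i t ht
    rw [hk, he, max_eq_left ht.1]
    refine mul_le_mul (hbφ i t ht) ?_ (hnn i _ fun _ => le_max_right _ _) (φ0 i)
    apply hmono i _ _ fun _ => le_max_right _ _
    intro l
    apply max_le_max _ le_rfl
    rw [hW]
    exact Finset.single_le_sum (f := fun j => w j t) (fun j _ => hwnn j t ht.1) (Finset.mem_univ l)
  have hq1 : p/(p-1) - 1 = 1/(p-1) := by field_simp; ring
  have hqge : 1 ≤ p/(p-1) := by rw [le_div_iff₀ hq0]; linarith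
  have hqpos : 0 < p/(p-1) := by positivity
  -- energy inequality
  have hEn : ∀ i, ∀ t ∈ Icc 0 R,
      (h i t) ^ (p/(p-1)) ≤ p/(p-1) * φ i * ∫ s in (1:ℝ)..(W t), e i s := by
    intro i
    have hmon : MonotoneOn (fun t => p/(p-1) * φ i * (∫ s in (1:ℝ)..(W t), e i s)
        - (h i t) ^ (p/(p-1))) (Icc 0 R) := by
      have hder : ∀ t ∈ Ioo 0 R, ∃ D, HasDerivAt
          (fun t => p/(p-1) * φ i * (∫ s in (1:ℝ)..(W t), e i s) - (h i t) ^ (p/(p-1))) D t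
          ∧ 0 ≤ D := by
        intro t ht
        obtain ⟨h', hd, hle⟩ := (hA i).2.2.2 t ht.1
        have d1 := (((ec i).integral_hasStrictDerivAt 1 (W t)).hasDerivAt.comp t (hWd t ht.1)).const_mul
          (p/(p-1) * φ i)
        have d2 := hd.rpow_const (p := p/(p-1)) (Or.inr hqge)
        refine ⟨_, d1.sub d2, ?_⟩
        rw [hq1, ← hg]
        have i1 : h' ≤ φ i * e i (W t) := hle.trans (hke i t ⟨ht.1.le, ht.2.le⟩)
        have i2 : g i t ≤ ∑ j, g j t :=
          Finset.single_le_sum (f := fun j => g j t) (fun j _ => hg0 j t ht.1.le) (Finset.mem_univ i)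
        have i3 : h' * g i t ≤ (φ i * e i (W t)) * ∑ j, g j t :=
          (mul_le_mul_of_nonneg_right i1 (hg0 i t ht.1.le)).trans
            (mul_le_mul_of_nonneg_left i2 (mul_nonneg (φ0 i) (e0 i _)))
        have i4 := mul_le_mul_of_nonneg_left i3 hqpos.le
        linarith
      apply monotoneOn_of_deriv_nonneg (convex_Icc 0 R)
      · apply ContinuousOn.sub
        · apply ContinuousOn.mul continuousOn_const
          have : Continuous (fun y => ∫ s in (1:ℝ)..y, e i s) :=
            intervalIntegral.continuous_primitive (fun a b => (ec i).intervalIntegrable a b) 1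
          exact this.comp_continuousOn (hWc.mono Icc_subset_Ici_self)
        · exact ((hA i).2.2.1.mono Icc_subset_Ici_self).rpow_const fun t _ => Or.inr hqpos.le
      · rw [interior_Icc]
        intro t ht
        obtain ⟨D, hD, -⟩ := hder t ht
        exact hD.differentiableAt.differentiableWithinAt
      · rw [interior_Icc]
        intro t ht
        obtain ⟨D, hD, hD0⟩ := hder t ht
        rw [hD.deriv]; exact hD0
    intro t ht
    have := hmon (left_mem_Icc.2 hR.le) ht ht.1
    simp only [hW0, (hA i).2.1, Real.zero_rpow hqpos.ne', intervalIntegral.integral_same,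
      mul_zero, sub_zero] at this
    linarith
  obtain ⟨G, hG⟩ : ∃ G : ℝ → ℝ, ∀ y, G y = ∫ s in (1:ℝ)..y, ∑ i, e i s := ⟨_, fun _ => rfl⟩
  have Ec : Continuous (fun s => ∑ i, e i s) := continuous_finsetSum _ fun i _ => ec i
  have Gc : Continuous G := by
    rw [show G = _ from funext hG]
    exact intervalIntegral.continuous_primitive (fun a b => Ec.intervalIntegrable a b) 1
  have Gpos : ∀ y, 1 < y → 0 < G y := by
    intro y hy
    rw [hG]
    apply intervalIntegral.intervalIntegral_pos_of_pos_on (Ec.intervalIntegrable _ _) _ hy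
    intro s hs
    apply Finset.sum_pos
    · intro i _
      rw [he]
      exact hpos i _ fun _ => lt_max_of_lt_left (one_pos.trans hs.1)
    · exact ⟨⟨0, hm⟩, Finset.mem_univ _⟩
  have hGsum : ∀ y, G y = ∑ i, ∫ s in (1:ℝ)..y, e i s := fun y => by
    rw [hG]
    exact intervalIntegral.integral_finsetSum fun i _ => (ec i).intervalIntegrable _ _
  simp only [← hφ]
  rw [← hW]
  obtain ⟨C, hCdef⟩ : ∃ C, C = (p * (m:ℝ) ^ (p-1) / (p-1)) * ∑ i, φ i := ⟨_, rfl⟩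
  rw [← hCdef]
  have hφs : 0 ≤ ∑ i, φ i := Finset.sum_nonneg fun i _ => φ0 i
  have hC0 : 0 ≤ C := by rw [hCdef]; positivity
  have hWp : ∀ t ∈ Icc 0 R, (∑ i, g i t) ^ p ≤ C * G (W t) := by
    intro t ht
    have s1 := Real.rpow_sum_le_const_mul_sum_rpow_of_nonneg (Finset.univ : Finset (Fin m))
      (f := fun i => g i t) (p := p) hp1.le (fun i _ => hg0 i t ht.1)
    rw [Finset.card_univ, Fintype.card_fin] at s1
    have s2 : ∑ i, (g i t) ^ p ≤ ∑ i, p/(p-1) * φ i * G (W t) := by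
      apply Finset.sum_le_sum
      intro i _
      have : (g i t) ^ p = (h i t) ^ (p/(p-1)) := by
        rw [hg, ← Real.rpow_mul (hh0 i t ht.1)]; congr 1; field_simp
      rw [this]
      refine (hEn i t ht).trans (mul_le_mul_of_nonneg_left ?_ (mul_nonneg hqpos.le (φ0 i)))
      rw [hGsum]
      exact Finset.single_le_sum (f := fun j => ∫ s in (1:ℝ)..(W t), e j s)
        (fun j _ => intervalIntegral.integral_nonneg (hW1 t ht.1) fun s _ => e0 j s)
        (Finset.mem_univ i)
    calc _ ≤ _ := s1
      _ ≤ (m:ℝ) ^ (p-1) * ∑ i, p/(p-1) * φ i * G (W t) :=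
          mul_le_mul_of_nonneg_left s2 (by positivity)
      _ = C * G (W t) := by
          rw [hCdef, ← Finset.sum_mul, ← Finset.mul_sum]; ring
  have hCr : 0 ≤ C ^ (1/p) := Real.rpow_nonneg hC0 _
  have hRHS : 0 ≤ C ^ (1/p) * R := mul_nonneg hCr hR.le
  have hcongr : ∫ t in (1:ℝ)..(W R), (∫ s in (1:ℝ)..t, ∑ i, f i (fun _ => s)) ^ (-1/p)
      = ∫ t in (1:ℝ)..(W R), (G t) ^ (-1/p) := by
    apply intervalIntegral.integral_congr
    intro t ht
    rw [uIcc_of_le (hW1 R hR.le)] at ht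
    simp only
    rw [hG]
    congr 1
    apply intervalIntegral.integral_congr
    intro s hs
    rw [uIcc_of_le ht.1] at hs
    simp only
    refine Finset.sum_congr rfl fun i _ => ?_
    rw [he, max_eq_left (by linarith [hs.1])]
  rw [hcongr]
  by_cases hint : IntervalIntegrable (fun t => (G t) ^ (-1/p)) volume 1 (W R)
  swap
  · rw [intervalIntegral.integral_undef hint]; exact hRHS
  rcases eq_or_lt_of_le (hW1 R hR.le) with h1 | h1
  · rw [← h1, intervalIntegral.integral_same]; exact hRHS
  -- truncated bound
  have hx : ∀ x ∈ Ioo 1 (W R), ∫ t in x..(W R), (G t) ^ (-1/p) ≤ C ^ (1/p) * R := by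
    intro x hx
    obtain ⟨a, ha, hax⟩ : ∃ a ∈ Icc 0 R, W a = x := by
      have := intermediate_value_Icc hR.le (hWc.mono (fun t (ht : t ∈ Icc 0 R) => ht.1))
      rw [hW0] at this
      exact this ⟨hx.1.le, hx.2.le⟩
    have haR : a < R := by
      rcases eq_or_lt_of_le ha.2 with h | h
      · rw [h] at hax; linarith [hx.2]
      · exact h
    have ψc : Continuous (fun y => (G (max y x)) ^ (-1/p)) := by
      have : Continuous (fun y => G (max y x)) := Gc.comp (by fun_prop)
      exact this.rpow_const fun y => Or.inl (Gpos _ (lt_max_of_lt_right hx.1)).ne'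
    have hWx : ∀ t ∈ Icc a R, x ≤ W t := fun t ht => by
      rw [← hax]; exact hWm (mem_Ici.2 ha.1) (mem_Ici.2 (ha.1.trans ht.1)) ht.1
    have hmon : MonotoneOn (fun t => C ^ (1/p) * t - ∫ y in x..(W t), (G (max y x)) ^ (-1/p))
        (Icc a R) := by
      have hder : ∀ t ∈ Ioo a R, ∃ D, HasDerivAt
          (fun t => C ^ (1/p) * t - ∫ y in x..(W t), (G (max y x)) ^ (-1/p)) D t ∧ 0 ≤ D := by
        intro t ht
        have ht0 : 0 < t := lt_of_le_of_lt ha.1 ht.1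
        have d1 := (ψc.integral_hasStrictDerivAt x (W t)).hasDerivAt.comp t (hWd t ht0)
        have d2 := (hasDerivAt_id t).const_mul (C ^ (1/p))
        refine ⟨_, d2.sub d1, ?_⟩
        have hxt := hWx t ⟨ht.1.le, ht.2.le⟩
        rw [max_eq_left hxt]
        have hGp : 0 < G (W t) := Gpos _ (hx.1.trans_le hxt)
        have h2 := hWp t ⟨ht0.le, ht.2.le⟩
        have h3 : ∑ i, g i t ≤ C ^ (1/p) * (G (W t)) ^ (1/p) := by
          rw [← Real.mul_rpow hC0 hGp.le]
          have := Real.rpow_le_rpow (Real.rpow_nonneg (hgs0 t ht0.le) _) h2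
            (show 0 ≤ 1/p by positivity)
          rwa [← Real.rpow_mul (hgs0 t ht0.le), mul_one_div_cancel hp0.ne', Real.rpow_one] at this
        have h4 := mul_le_mul_of_nonneg_left h3 (Real.rpow_nonneg hGp.le (-1/p))
        have h5 : (G (W t)) ^ (-1/p) * (C ^ (1/p) * (G (W t)) ^ (1/p)) = C ^ (1/p) := by
          rw [mul_left_comm, ← Real.rpow_add hGp, ← add_div]; simp
        rw [h5] at h4
        linarith
      apply monotoneOn_of_deriv_nonneg (convex_Icc a R)
      · apply ContinuousOn.sub (by fun_prop)
        have : Continuous (fun y => ∫ s in x..y, (G (max s x)) ^ (-1/p)) :=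
          intervalIntegral.continuous_primitive (fun a b => ψc.intervalIntegrable a b) x
        exact this.comp_continuousOn (hWc.mono fun t ht => ha.1.trans ht.1)
      · rw [interior_Icc]
        intro t ht
        obtain ⟨D, hD, -⟩ := hder t ht
        exact hD.differentiableAt.differentiableWithinAt
      · rw [interior_Icc]
        intro t ht
        obtain ⟨D, hD, hD0⟩ := hder t ht
        rw [hD.deriv]; exact hD0
    have hfin := hmon (left_mem_Icc.2 haR.le) (right_mem_Icc.2 haR.le) haR.le
    simp only [hax, intervalIntegral.integral_same, sub_zero] at hfin
    have heq : ∫ t in x..(W R), (G t) ^ (-1/p) = ∫ y in x..(W R), (G (max y x)) ^ (-1/p) := by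
      apply intervalIntegral.integral_congr
      intro y hy
      rw [uIcc_of_le hx.2.le] at hy
      simp only
      rw [max_eq_left hy.1]
    rw [heq]
    have := mul_nonneg hCr ha.1
    linarith
  -- let x tend to 1
  have hcont : ContinuousOn (fun x => ∫ t in x..(W R), (G t) ^ (-1/p)) (Icc 1 (W R)) := by
    have := intervalIntegral.continuousOn_primitive_interval_left
      (f := fun t => (G t) ^ (-1/p)) (μ := volume) (a := 1) (b := W R)
      (by rw [uIcc_of_le h1.le]
          exact (intervalIntegrable_iff_integrableOn_Icc_of_le h1.le).1 hint)
    rwa [uIcc_of_le h1.le] at this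
  have hlim := (hcont 1 (left_mem_Icc.2 h1.le)).tendsto.mono_left
    (nhdsWithin_mono 1 (Ioo_subset_Icc_self (a := (1:ℝ)) (b := W R)))
  have : (nhdsWithin (1:ℝ) (Ioo 1 (W R))).NeBot := left_nhdsWithin_Ioo_neBot h1
  refine le_of_tendsto hlim ?_
  filter_upwards [self_mem_nhdsWithin] with x hxx using hx x hxx
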